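/- Let n ≥ 2, α ∈ (0,1), and let h : [0,∞) → [0,∞) be convex, strictly increasing, with h(0) = 0; set g(x) = h(|x|). Let m > 0 and a > 0 with |B_a| = m. If (E_i) is a sequence of measurable subsets of ℝⁿ with |E_i| = m for all i and 𝓔(E_i) − 𝓔(B_a) → 0 as i → ∞, then |E_i Δ B_a| → 0. -/

import Mathlib

open MeasureTheory Metric Set Filter
open scoped ENNReal Topology

/-- The fractional (nonlocal) perimeter `P_α(E) = ∫_E ∫_{Eᶜ} |x-y|^{-(n+α)} dy dx`. -/
noncomputable def fracPerimeter (n : ℕ) (α : ℝ) (E : Set (EuclideanSpace ℝ (Fin n))) : ℝ≥0∞ :=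
  ∫⁻ x in E, ∫⁻ y in Eᶜ, ENNReal.ofReal (‖x - y‖ ^ (-((n : ℝ) + α)))

/-- The nonlocal free energy `𝓔(E) = P_α(E) + ∫_E g`. -/
noncomputable def freeEnergy (n : ℕ) (α : ℝ) (g : EuclideanSpace ℝ (Fin n) → ℝ)
    (E : Set (EuclideanSpace ℝ (Fin n))) : ℝ≥0∞ :=
  fracPerimeter n α E + ∫⁻ x in E, ENNReal.ofReal (g x)

section Reflection

variable {V : Type*} [NormedAddCommGroup V] [InnerProductSpace ℝ V]

/-- The reflection across the perpendicular bisector of the segment from `0` to `p`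
(the identity if `p = 0`). -/
noncomputable def mirror (p x : V) : V := p - (Submodule.span ℝ {p}).reflection x

lemma mirror_apply (p x : V) : mirror p x = x + p - (2 * (inner ℝ p x / ‖p‖ ^ 2)) • p := by
  rw [mirror, Submodule.reflection_singleton_apply]
  simp only [RCLike.ofReal_real_eq_id, id_eq, two_smul, two_mul, add_smul]
  abel

lemma norm_mirror_sub_mirror (p x y : V) : ‖mirror p x - mirror p y‖ = ‖x - y‖ := by
  rw [mirror, mirror, sub_sub_sub_cancel_left, ← map_sub, LinearIsometryEquiv.norm_map,
    norm_sub_rev]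

lemma mirror_mirror (p x : V) : mirror p (mirror p x) = x := by
  have hp : (Submodule.span ℝ {p}).reflection p = p :=
    Submodule.reflection_mem_subspace_eq_self (Submodule.mem_span_singleton_self p)
  simp [mirror, hp]

lemma norm_mirror_sub (p x y : V) : ‖mirror p x - y‖ = ‖x - mirror p y‖ := by
  rw [← norm_mirror_sub_mirror p x, mirror_mirror]

lemma mirror_apply' {p : V} (x : V) :
    mirror p x = x + (1 - 2 * (inner ℝ p x / ‖p‖ ^ 2)) • p := by
  rw [mirror_apply, sub_smul, one_smul]; abel

lemma norm_mirror_sq_sub {p : V} (hp : p ≠ 0) (x : V) :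
    ‖mirror p x‖ ^ 2 - ‖x‖ ^ 2 = (1 - 2 * (inner ℝ p x / ‖p‖ ^ 2)) * ‖p‖ ^ 2 := by
  have h : ‖p‖ ≠ 0 := norm_ne_zero_iff.mpr hp
  rw [mirror_apply', norm_add_sq_real, norm_smul, inner_smul_right, mul_pow, Real.norm_eq_abs,
    sq_abs, real_inner_comm p x]
  field_simp
  ring

lemma mirror_eq_self_of_norm_eq {p x : V} (h : ‖x‖ = ‖mirror p x‖) : mirror p x = x := by
  rcases eq_or_ne p 0 with rfl | hp
  · simp [mirror_apply']
  · have h1 := norm_mirror_sq_sub hp x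
    have h2 : ‖p‖ ^ 2 ≠ 0 := by positivity
    rw [← h, sub_self] at h1
    rw [mirror_apply', (mul_eq_zero.mp h1.symm).resolve_right h2, zero_smul, add_zero]

lemma norm_sub_le_norm_sub_mirror {p x y : V} (hx : ‖x‖ ≤ ‖mirror p x‖)
    (hy : ‖y‖ ≤ ‖mirror p y‖) : ‖x - y‖ ≤ ‖x - mirror p y‖ := by
  rcases eq_or_ne p 0 with rfl | hp
  · simp [mirror_apply']
  have hp2 : 0 < ‖p‖ ^ 2 := by positivity
  have key : ∀ z : V, ‖z‖ ≤ ‖mirror p z‖ → 0 ≤ 1 - 2 * (inner ℝ p z / ‖p‖ ^ 2) := by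
    intro z hz
    have h1 := norm_mirror_sq_sub hp z
    have h2 : ‖z‖ ^ 2 ≤ ‖mirror p z‖ ^ 2 := by gcongr
    exact nonneg_of_mul_nonneg_left (by linarith) hp2
  have hx' := key x hx
  have hy' := key y hy
  refine le_of_sq_le_sq ?_ (norm_nonneg _)
  have : ‖x - mirror p y‖ ^ 2 - ‖x - y‖ ^ 2 = (1 - 2 * (inner ℝ p x / ‖p‖ ^ 2)) *
      (1 - 2 * (inner ℝ p y / ‖p‖ ^ 2)) * ‖p‖ ^ 2 := by
    rw [mirror_apply', ← sub_sub, norm_sub_sq_real (x - y), norm_smul, inner_smul_right, mul_pow,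
      Real.norm_eq_abs, sq_abs, real_inner_comm p (x - y), inner_sub_right]
    field_simp
    ring
  nlinarith [mul_nonneg (mul_nonneg hx' hy') hp2.le]

/-- The polarization (two-point symmetrization) of `F` towards the half-space containing `0`
that is bounded by the mirror of `mirror p`. -/
def polarize (p : V) (F : Set V) : Set V :=
  {x | (‖x‖ ≤ ‖mirror p x‖ ∧ (x ∈ F ∨ mirror p x ∈ F)) ∨ (x ∈ F ∧ mirror p x ∈ F)}

lemma mem_polarize {p x : V} {F : Set V} (hx : ‖x‖ ≤ ‖mirror p x‖) :
    x ∈ polarize p F ↔ x ∈ F ∨ mirror p x ∈ F := by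
  simp only [polarize, Set.mem_ofPred_eq, hx, true_and]
  tauto

lemma mirror_mem_polarize {p x : V} {F : Set V} (hx : ‖x‖ ≤ ‖mirror p x‖) :
    mirror p x ∈ polarize p F ↔ x ∈ F ∧ mirror p x ∈ F := by
  simp only [polarize, Set.mem_ofPred_eq, mirror_mirror]
  constructor
  · rintro (⟨h, h'⟩ | h)
    · rw [mirror_eq_self_of_norm_eq (le_antisymm hx h)] at h' ⊢
      tauto
    · tauto
  · tauto

end Reflection

section Polarization

variable {n : ℕ}

lemma measurePreserving_mirror (p : EuclideanSpace ℝ (Fin n)) :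
    MeasurePreserving (mirror p) := by
  exact (Measure.measurePreserving_sub_left volume p).comp
    (LinearIsometryEquiv.measurePreserving (Submodule.span ℝ {p}).reflection)

lemma measurable_mirror_uncurry :
    Measurable fun z : EuclideanSpace ℝ (Fin n) × EuclideanSpace ℝ (Fin n) =>
      mirror z.1 z.2 := by
  simp only [mirror_apply]
  fun_prop

lemma measurableSet_polarize (p : EuclideanSpace ℝ (Fin n)) {F : Set (EuclideanSpace ℝ (Fin n))}
    (hF : MeasurableSet F) : MeasurableSet (polarize p F) := by
  have hm := (measurePreserving_mirror p).measurable
  exact ((measurableSet_le measurable_norm hm.norm).inter (hF.union (hm hF))).union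
    (hF.inter (hm hF))

lemma lintegral_le_lintegral_of_mirror {p : EuclideanSpace ℝ (Fin n)}
    {f g : EuclideanSpace ℝ (Fin n) → ℝ≥0∞} (hf : Measurable f) (hg : Measurable g)
    (h : ∀ x, ‖x‖ ≤ ‖mirror p x‖ → f x + f (mirror p x) ≤ g x + g (mirror p x)) :
    ∫⁻ x, f x ≤ ∫⁻ x, g x := by
  have hp := measurePreserving_mirror p
  have h' : ∀ x, f x + f (mirror p x) ≤ g x + g (mirror p x) := by
    intro x
    rcases le_total ‖x‖ ‖mirror p x‖ with hx | hx
    · exact h x hx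
    · have := h (mirror p x) (by rwa [mirror_mirror])
      rw [mirror_mirror] at this
      rwa [add_comm (f x), add_comm (g x)]
  have h2 := lintegral_mono h' (μ := volume)
  rw [lintegral_add_left hf, lintegral_add_left hg, hp.lintegral_comp hf, hp.lintegral_comp hg,
    ← two_mul, ← two_mul] at h2
  exact (ENNReal.mul_le_mul_iff_right (by simp) (by simp)).mp h2

lemma volume_polarize (p : EuclideanSpace ℝ (Fin n)) {F : Set (EuclideanSpace ℝ (Fin n))}
    (hF : MeasurableSet F) : volume (polarize p F) = volume F := by
  classical
  have hP := measurableSet_polarize p hF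
  have key : ∀ x, ‖x‖ ≤ ‖mirror p x‖ →
      (polarize p F).indicator (1 : EuclideanSpace ℝ (Fin n) → ℝ≥0∞) x +
        (polarize p F).indicator 1 (mirror p x) =
      F.indicator 1 x + F.indicator 1 (mirror p x) := by
    intro x hx
    simp only [indicator_apply, mem_polarize hx, mirror_mem_polarize hx]
    by_cases h1 : x ∈ F <;> by_cases h2 : mirror p x ∈ F <;> simp [h1, h2]
  rw [← lintegral_indicator_one hP, ← lintegral_indicator_one hF]
  exact le_antisymm
    (lintegral_le_lintegral_of_mirror (measurable_one.indicator hP) (measurable_one.indicator hF)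
      fun x hx => (key x hx).le)
    (lintegral_le_lintegral_of_mirror (measurable_one.indicator hF) (measurable_one.indicator hP)
      fun x hx => (key x hx).ge)

lemma volume_polarize_diff_ball_add_le (p : EuclideanSpace ℝ (Fin n))
    {F : Set (EuclideanSpace ℝ (Fin n))} (hF : MeasurableSet F) (r : ℝ) :
    volume (polarize p F \ ball 0 r) + volume ((ball 0 r \ F) ∩ mirror p ⁻¹' (F \ ball 0 r)) ≤
      volume (F \ ball 0 r) := by
  classical
  have hP := (measurableSet_polarize p hF).diff (measurableSet_ball (x := 0) (ε := r))
  have hFB := hF.diff (measurableSet_ball (x := 0) (ε := r))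
  have hG : MeasurableSet ((ball 0 r \ F) ∩ mirror p ⁻¹' (F \ ball 0 r)) :=
    (measurableSet_ball.diff hF).inter ((measurePreserving_mirror p).measurable hFB)
  rw [← lintegral_indicator_one hP, ← lintegral_indicator_one hFB, ← lintegral_indicator_one hG,
    ← lintegral_add_left (measurable_one.indicator hP)]
  refine lintegral_le_lintegral_of_mirror (p := p)
    ((measurable_one.indicator hP).add (measurable_one.indicator hG))
    (measurable_one.indicator hFB) fun x hx => ?_
  simp only [indicator_apply, mem_inter_iff, Set.mem_sdiff, mem_preimage, mem_polarize hx,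
    mirror_mem_polarize hx, mirror_mirror, mem_ball_zero_iff, Pi.one_apply]
  by_cases h1 : x ∈ F <;> by_cases h2 : mirror p x ∈ F <;> by_cases h3 : ‖x‖ < r <;>
    by_cases h4 : ‖mirror p x‖ < r <;> simp [h1, h2, h3, h4] <;> linarith

end Polarization

section Perimeter

variable {n : ℕ}

open Classical in
lemma fracPerimeter_eq_lintegral_lintegral (α : ℝ) {F : Set (EuclideanSpace ℝ (Fin n))}
    (hF : MeasurableSet F) :
    fracPerimeter n α F = ∫⁻ x, ∫⁻ y, if x ∈ F ∧ y ∉ F then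
      ENNReal.ofReal (‖x - y‖ ^ (-((n : ℝ) + α))) else 0 := by
  rw [fracPerimeter, ← lintegral_indicator hF]
  congr 1 with x
  by_cases hx : x ∈ F
  · rw [indicator_of_mem hx, ← lintegral_indicator hF.compl]
    simp [indicator_apply, hx]
  · simp [hx]

open Classical in
lemma measurable_perimeter_integrand (α : ℝ) {F : Set (EuclideanSpace ℝ (Fin n))}
    (hF : MeasurableSet F) :
    Measurable fun z : EuclideanSpace ℝ (Fin n) × EuclideanSpace ℝ (Fin n) =>
      if z.1 ∈ F ∧ z.2 ∉ F then ENNReal.ofReal (‖z.1 - z.2‖ ^ (-((n : ℝ) + α))) else 0 := by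
  refine Measurable.ite (hF.prod hF.compl) ?_ measurable_const
  fun_prop

open Classical in
lemma measurable_perimeter_integrand_right (α : ℝ) {F : Set (EuclideanSpace ℝ (Fin n))}
    (hF : MeasurableSet F) (x : EuclideanSpace ℝ (Fin n)) :
    Measurable fun y : EuclideanSpace ℝ (Fin n) =>
      if x ∈ F ∧ y ∉ F then ENNReal.ofReal (‖x - y‖ ^ (-((n : ℝ) + α))) else 0 :=
  (measurable_perimeter_integrand α hF).comp measurable_prodMk_left

lemma fracPerimeter_polarize_le {α : ℝ} (hα : 0 ≤ α) (p : EuclideanSpace ℝ (Fin n))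
    {F : Set (EuclideanSpace ℝ (Fin n))} (hF : MeasurableSet F) :
    fracPerimeter n α (polarize p F) ≤ fracPerimeter n α F := by
  classical
  have hP := measurableSet_polarize p hF
  have mP := fun x => measurable_perimeter_integrand_right α hP x
  have mF := fun x => measurable_perimeter_integrand_right α hF x
  rw [fracPerimeter_eq_lintegral_lintegral α hP, fracPerimeter_eq_lintegral_lintegral α hF]
  refine lintegral_le_lintegral_of_mirror (p := p)
    (measurable_perimeter_integrand α hP).lintegral_prod_right
    (measurable_perimeter_integrand α hF).lintegral_prod_right fun x hx => ?_
  rw [← lintegral_add_left (mP x), ← lintegral_add_left (mF x)]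
  refine lintegral_le_lintegral_of_mirror (p := p) ((mP _).add (mP _)) ((mF _).add (mF _))
    fun y hy => ?_
  simp only [mem_polarize hx, mirror_mem_polarize hx, mem_polarize hy, mirror_mem_polarize hy,
    norm_mirror_sub, mirror_mirror]
  rcases eq_or_ne x y with rfl | hxy
  · by_cases h1 : x ∈ F <;> by_cases h2 : mirror p x ∈ F <;> simp [h1, h2]
  have hle : ENNReal.ofReal (‖x - mirror p y‖ ^ (-((n : ℝ) + α))) ≤
      ENNReal.ofReal (‖x - y‖ ^ (-((n : ℝ) + α))) :=
    ENNReal.ofReal_le_ofReal <| Real.rpow_le_rpow_of_nonpos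
      (norm_pos_iff.mpr (sub_ne_zero.mpr hxy)) (norm_sub_le_norm_sub_mirror hx hy)
      (neg_nonpos.mpr (by positivity))
  generalize ENNReal.ofReal (‖x - mirror p y‖ ^ (-((n : ℝ) + α))) = k₂ at *
  generalize ENNReal.ofReal (‖x - y‖ ^ (-((n : ℝ) + α))) = k₁ at *
  by_cases h1 : x ∈ F <;> by_cases h2 : mirror p x ∈ F <;> by_cases h3 : y ∈ F <;>
    by_cases h4 : mirror p y ∈ F <;> simp [h1, h2, h3, h4, add_comm, hle]

end Perimeter

section Transport

lemma norm_inv_norm_smul_sub_le {V : Type*} [NormedAddCommGroup V] [NormedSpace ℝ V] {η : ℝ}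
    (hη : 0 < η) {p q : V} (hp : η ≤ ‖p‖) (hq : η ≤ ‖q‖) :
    ‖‖p‖⁻¹ • p - ‖q‖⁻¹ • q‖ ≤ 2 / η * ‖p - q‖ := by
  have hp0 : 0 < ‖p‖ := hη.trans_le hp
  have hq0 : 0 < ‖q‖ := hη.trans_le hq
  have h1 : ‖p‖⁻¹ • p - ‖q‖⁻¹ • q = ‖p‖⁻¹ • (p - q) + (‖p‖⁻¹ - ‖q‖⁻¹) • q := by
    rw [smul_sub, sub_smul]; abel
  have h2 : ‖(‖p‖⁻¹ - ‖q‖⁻¹) • q‖ ≤ ‖p‖⁻¹ * ‖p - q‖ := by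
    have h3 : (‖p‖⁻¹ - ‖q‖⁻¹) = (‖q‖ - ‖p‖) * (‖p‖⁻¹ * ‖q‖⁻¹) := by field_simp
    rw [norm_smul, h3, Real.norm_eq_abs, abs_mul,
      abs_of_pos (a := ‖p‖⁻¹ * ‖q‖⁻¹) (by positivity)]
    calc |‖q‖ - ‖p‖| * (‖p‖⁻¹ * ‖q‖⁻¹) * ‖q‖ = ‖p‖⁻¹ * |‖q‖ - ‖p‖| := by field_simp
      _ ≤ ‖p‖⁻¹ * ‖p - q‖ := by
        gcongr
        rw [norm_sub_rev]
        exact abs_norm_sub_norm_le q p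
  have h4 : ‖p‖⁻¹ ≤ η⁻¹ := by gcongr
  calc _ ≤ ‖‖p‖⁻¹ • (p - q)‖ + ‖(‖p‖⁻¹ - ‖q‖⁻¹) • q‖ := by rw [h1]; exact norm_add_le _ _
    _ ≤ ‖p‖⁻¹ * ‖p - q‖ + ‖p‖⁻¹ * ‖p - q‖ := by
        gcongr
        rw [norm_smul, norm_inv, norm_norm]
    _ ≤ η⁻¹ * ‖p - q‖ + η⁻¹ * ‖p - q‖ := by gcongr
    _ = _ := by ring

variable {V : Type*} [NormedAddCommGroup V] [InnerProductSpace ℝ V]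

lemma mirror_eq_normalized (p x : V) :
    mirror p x = x + p - (2 : ℝ) • (inner ℝ (‖p‖⁻¹ • p) x • (‖p‖⁻¹ • p)) := by
  rw [mirror_apply, real_inner_smul_left, smul_smul, smul_smul]
  congr 2
  ring

lemma lipschitzOnWith_mirror {b η : ℝ} (hη : 0 < η) {x : V} (hx : ‖x‖ ≤ b) :
    LipschitzOnWith (1 + 8 * b / η).toNNReal (fun p => mirror p x) {p | η ≤ ‖p‖} := by
  have hb : 0 ≤ b := (norm_nonneg x).trans hx
  refine LipschitzOnWith.of_dist_le_mul fun p hp q hq => ?_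
  rw [dist_eq_norm, dist_eq_norm, Real.coe_toNNReal _ (by positivity)]
  have hu := norm_inv_norm_smul_sub_le hη hp hq
  have hp1 : ‖‖p‖⁻¹ • p‖ ≤ 1 := by
    rw [norm_smul, norm_inv, norm_norm]; exact inv_mul_le_one
  have hq1 : ‖‖q‖⁻¹ • q‖ ≤ 1 := by
    rw [norm_smul, norm_inv, norm_norm]; exact inv_mul_le_one
  simp only [mirror_eq_normalized]
  generalize ‖p‖⁻¹ • p = u at *
  generalize ‖q‖⁻¹ • q = v at *
  have h1 : x + p - (2 : ℝ) • (inner ℝ u x • u) - (x + q - (2 : ℝ) • (inner ℝ v x • v)) =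
      (p - q) - (2 : ℝ) • (inner ℝ (u - v) x • u + inner ℝ v x • (u - v)) := by
    rw [inner_sub_left]; module
  have h2 : ‖inner ℝ (u - v) x • u‖ ≤ ‖u - v‖ * b * 1 := by
    rw [norm_smul]
    gcongr
    exact (norm_inner_le_norm _ _).trans (by gcongr)
  have h3 : ‖inner ℝ v x • (u - v)‖ ≤ 1 * b * ‖u - v‖ := by
    rw [norm_smul]
    gcongr
    exact (norm_inner_le_norm _ _).trans (by gcongr)
  calc _ ≤ ‖p - q‖ + 2 * ‖inner ℝ (u - v) x • u + inner ℝ v x • (u - v)‖ := by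
        rw [h1]
        refine (norm_sub_le _ _).trans ?_
        rw [norm_smul]; simp
    _ ≤ ‖p - q‖ + 2 * (‖u - v‖ * b * 1 + 1 * b * ‖u - v‖) := by
        gcongr
        exact (norm_add_le _ _).trans (add_le_add h2 h3)
    _ = ‖p - q‖ + 4 * b * ‖u - v‖ := by ring
    _ ≤ ‖p - q‖ + 4 * b * (2 / η * ‖p - q‖) := by gcongr
    _ = _ := by ring

lemma exists_mirror_eq {x y : V} (hxy : ‖x‖ < ‖y‖) :
    ∃ p, mirror p x = y ∧ ‖y‖ - ‖x‖ ≤ ‖p‖ ∧ ‖p‖ ≤ ‖x‖ + ‖y‖ := by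
  have hne : y - x ≠ 0 := by
    intro h
    rw [sub_eq_zero.mp h] at hxy
    exact lt_irrefl _ hxy
  obtain ⟨d, rfl⟩ : ∃ d, y = x + d := ⟨y - x, by abel⟩
  rw [add_sub_cancel_left] at hne
  have hd : 0 < ‖d‖ := norm_pos_iff.mpr hne
  have hsq : ‖x + d‖ ^ 2 - ‖x‖ ^ 2 = ‖d‖ ^ 2 + 2 * inner ℝ d x := by
    rw [norm_add_sq_real, real_inner_comm]; ring
  have hpos : 0 < ‖x + d‖ ^ 2 - ‖x‖ ^ 2 := by nlinarith [norm_nonneg x]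
  have hnorm : ‖((‖x + d‖ ^ 2 - ‖x‖ ^ 2) / ‖d‖ ^ 2) • d‖ =
      (‖x + d‖ - ‖x‖) * (‖x‖ + ‖x + d‖) / ‖d‖ := by
    rw [norm_smul, Real.norm_of_nonneg (by positivity)]
    field_simp
    ring
  refine ⟨((‖x + d‖ ^ 2 - ‖x‖ ^ 2) / ‖d‖ ^ 2) • d, ?_, ?_, ?_⟩
  · rw [mirror_apply', norm_smul, real_inner_smul_left, Real.norm_of_nonneg (by positivity),
      smul_smul]
    have h0 := hpos.ne'
    rw [hsq] at h0 ⊢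
    have : (1 - 2 * ((‖d‖ ^ 2 + 2 * inner ℝ d x) / ‖d‖ ^ 2 * inner ℝ d x /
        ((‖d‖ ^ 2 + 2 * inner ℝ d x) / ‖d‖ ^ 2 * ‖d‖) ^ 2)) *
        ((‖d‖ ^ 2 + 2 * inner ℝ d x) / ‖d‖ ^ 2) = 1 := by
      field_simp
      ring
    rw [this, one_smul]
  · rw [hnorm, le_div_iff₀ hd]
    have : ‖d‖ ≤ ‖x‖ + ‖x + d‖ := by
      simpa [add_comm] using norm_sub_le (x + d) x
    have h2 : 0 ≤ ‖x + d‖ - ‖x‖ := by linarith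
    gcongr
  · rw [hnorm, div_le_iff₀ hd, mul_comm]
    have : ‖x + d‖ - ‖x‖ ≤ ‖d‖ := by linarith [norm_add_le x d]
    gcongr

variable {n : ℕ}

lemma LipschitzOnWith.volume_image_le {K : NNReal}
    {f : EuclideanSpace ℝ (Fin n) → EuclideanSpace ℝ (Fin n)} {s : Set (EuclideanSpace ℝ (Fin n))}
    (hf : LipschitzOnWith K f s) : volume (f '' s) ≤ (K : ℝ≥0∞) ^ n * volume s := by
  have h := hf.hausdorffMeasure_image_le (d := n) (by positivity)
  rw [Measure.isAddLeftInvariant_eq_smul (volume : Measure (EuclideanSpace ℝ (Fin n))) μH[n],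
    Measure.smul_apply, Measure.smul_apply, ENNReal.smul_def, smul_eq_mul, ENNReal.smul_def,
    smul_eq_mul, mul_left_comm]
  rw [ENNReal.rpow_natCast] at h
  gcongr

lemma exists_volume_mul_volume_le_of_mirror (n : ℕ) {b η R : ℝ} (hη : 0 < η) :
    ∃ K : ℝ≥0∞, K ≠ ∞ ∧ ∀ A C : Set (EuclideanSpace ℝ (Fin n)), MeasurableSet A →
      MeasurableSet C → C ⊆ ball 0 b → A ⊆ ball 0 R \ ball 0 (b + η) → ∀ γ : ℝ≥0∞,
      (∀ p, volume (C ∩ mirror p ⁻¹' A) ≤ γ) → volume C * volume A ≤ K * γ := by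
  classical
  set L : NNReal := (1 + 8 * b / η).toNNReal
  refine ⟨(L : ℝ≥0∞) ^ n * volume (closedBall (0 : EuclideanSpace ℝ (Fin n)) (b + R)),
    ENNReal.mul_ne_top (by finiteness) measure_closedBall_lt_top.ne,
    fun A C hA hC hCb hAR γ hγ => ?_⟩
  set Q : Set (EuclideanSpace ℝ (Fin n)) := {p | η ≤ ‖p‖} ∩ closedBall 0 (b + R) with hQ
  have hQm : MeasurableSet Q :=
    (measurableSet_le measurable_const measurable_norm).inter measurableSet_closedBall
  have hA' : ∀ x ∈ C, volume A ≤ (L : ℝ≥0∞) ^ n * volume ((fun p => mirror p x) ⁻¹' A ∩ Q) := by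
    intro x hx
    have hxb : ‖x‖ < b := by simpa using hCb hx
    refine le_trans (measure_mono ?_) (LipschitzOnWith.volume_image_le
      ((lipschitzOnWith_mirror hη hxb.le).mono
        (inter_subset_right.trans inter_subset_left)))
    intro y hy
    have hy1 : ‖y‖ < R := by simpa using (hAR hy).1
    have hy2 : b + η ≤ ‖y‖ := by simpa using (hAR hy).2
    obtain ⟨p, hp, hp1, hp2⟩ := exists_mirror_eq (x := x) (y := y) (by linarith)
    refine ⟨p, ⟨?_, ?_, ?_⟩, hp⟩
    · simpa [hp] using hy
    · simp only [Set.mem_ofPred_eq]; linarith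
    · simp only [mem_closedBall_zero_iff]; linarith
  have hmeas : Measurable fun z : EuclideanSpace ℝ (Fin n) × EuclideanSpace ℝ (Fin n) =>
      A.indicator (1 : EuclideanSpace ℝ (Fin n) → ℝ≥0∞) (mirror z.2 z.1) :=
    (measurable_one.indicator hA).comp (measurable_mirror_uncurry.comp measurable_swap)
  have hm1 : ∀ x, Measurable fun p : EuclideanSpace ℝ (Fin n) => mirror p x := fun x =>
    measurable_mirror_uncurry.comp measurable_prodMk_right
  calc volume C * volume A = ∫⁻ _ in C, volume A := by
        rw [setLIntegral_const, mul_comm]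
    _ ≤ ∫⁻ x in C, (L : ℝ≥0∞) ^ n * ∫⁻ p in Q, A.indicator 1 (mirror p x) := by
        refine setLIntegral_mono' hC fun x hx => (hA' x hx).trans_eq ?_
        rw [← Measure.restrict_apply (hm1 x hA), ← lintegral_indicator_one (hm1 x hA)]
        rfl
    _ = (L : ℝ≥0∞) ^ n * ∫⁻ p in Q, ∫⁻ x in C, A.indicator 1 (mirror p x) := by
        rw [lintegral_const_mul' _ _ (by finiteness), lintegral_lintegral_swap]
        exact hmeas.aemeasurable
    _ ≤ (L : ℝ≥0∞) ^ n * ∫⁻ p in Q, γ := by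
        gcongr with p
        refine le_trans (le_of_eq ?_) (hγ p)
        have hp := (measurePreserving_mirror p).measurable hA
        rw [inter_comm, ← Measure.restrict_apply hp, ← lintegral_indicator_one hp]
        rfl
    _ ≤ _ := by
        rw [setLIntegral_const, mul_comm γ, ← mul_assoc]
        gcongr
        exact inter_subset_right

end Transport

section Isoperimetric

variable {n : ℕ}

lemma exists_volume_ball_diff_ball_le (n : ℕ) {a : ℝ} (ha : 0 < a) :
    ∃ K : ℝ≥0∞, K ≠ ∞ ∧ ∀ t : ℝ, 0 ≤ t →
      volume (ball (0 : EuclideanSpace ℝ (Fin n)) a \ ball 0 (a - t)) ≤ K * ENNReal.ofReal t := by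
  set v := volume (ball (0 : EuclideanSpace ℝ (Fin n)) 1)
  have hv : v ≠ ∞ := measure_ball_lt_top.ne
  refine ⟨ENNReal.ofReal (a ^ n * (n + 1) / a) * v, by finiteness, fun t ht => ?_⟩
  rw [mul_right_comm, ← ENNReal.ofReal_mul (by positivity)]
  have hva := Measure.addHaar_ball_of_pos volume (0 : EuclideanSpace ℝ (Fin n)) ha
  rw [finrank_euclideanSpace, Fintype.card_fin] at hva
  have hts : 0 ≤ t / a := by positivity
  rcases lt_or_ge t a with hta | hta
  · have hvt := Measure.addHaar_ball_of_pos volume (0 : EuclideanSpace ℝ (Fin n))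
      (sub_pos.mpr hta)
    rw [finrank_euclideanSpace, Fintype.card_fin] at hvt
    rw [measure_sdiff (ball_subset_ball (by linarith)) measurableSet_ball.nullMeasurableSet
      measure_ball_lt_top.ne, hva, hvt, tsub_le_iff_right, ← add_mul,
      ← ENNReal.ofReal_add (by positivity) (pow_nonneg (by linarith) n)]
    gcongr
    have h1 : t / a < 1 := (div_lt_one ha).mpr hta
    have h2 := one_add_mul_le_pow (a := -(t / a)) (by linarith) n
    have h3 : (a - t) ^ n = a ^ n * (1 + -(t / a)) ^ n := by
      rw [← mul_pow]; congr 1; field_simp; ring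
    have h4 : a ^ n * (n + 1) / a * t = a ^ n * ((n + 1) * (t / a)) := by ring
    rw [h3, h4, ← mul_add]
    refine le_mul_of_one_le_right (by positivity) ?_
    linarith
  · refine (measure_mono sdiff_subset).trans ?_
    rw [hva]
    gcongr
    have h1 : 1 ≤ t / a := (one_le_div ha).mpr hta
    have h4 : a ^ n * (n + 1) / a * t = a ^ n * ((n + 1) * (t / a)) := by ring
    rw [h4]
    refine le_mul_of_one_le_right (by positivity) ?_
    nlinarith [(Nat.cast_nonneg n : (0 : ℝ) ≤ n)]

lemma exists_volume_ball_diff_ball_lt (n : ℕ) {a : ℝ} (ha : 0 < a) {ε : ℝ≥0∞} (hε : ε ≠ 0) :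
    ∃ η ∈ Ioo 0 a, volume (ball (0 : EuclideanSpace ℝ (Fin n)) a \ ball 0 (a - η)) < ε := by
  obtain ⟨K, hK, h⟩ := exists_volume_ball_diff_ball_le n ha
  have ht : Tendsto (fun t : ℝ => K * ENNReal.ofReal t) (𝓝[>] 0) (𝓝 0) := by
    have : Tendsto (fun t : ℝ => K * ENNReal.ofReal t) (𝓝 0) (𝓝 (K * ENNReal.ofReal 0)) :=
      ENNReal.Tendsto.const_mul (ENNReal.continuous_ofReal.tendsto 0) (Or.inr hK)
    simpa using this.mono_left nhdsWithin_le_nhds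
  obtain ⟨η, hη, hη'⟩ := ((ht.eventually_lt_const (pos_iff_ne_zero.mpr hε)).and
    (Ioo_mem_nhdsGT ha)).exists
  exact ⟨η, hη', (h η hη'.1.le).trans_lt hη⟩

lemma exists_volume_diff_ball_lt {E : Set (EuclideanSpace ℝ (Fin n))} (hE : MeasurableSet E)
    (hfin : volume E ≠ ∞) {ε : ℝ≥0∞} (hε : ε ≠ 0) : ∃ R : ℝ, volume (E \ ball 0 R) < ε := by
  have h : Tendsto (fun k : ℕ => volume (E \ ball 0 (k : ℝ))) atTop
      (𝓝 (volume (⋂ k : ℕ, E \ ball 0 (k : ℝ)))) := by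
    refine tendsto_measure_iInter_atTop
      (fun k => (hE.diff measurableSet_ball).nullMeasurableSet) ?_
      ⟨0, ((measure_mono sdiff_subset).trans_lt hfin.lt_top).ne⟩
    intro i j hij
    exact sdiff_subset_sdiff_right (ball_subset_ball (by exact_mod_cast hij))
  rw [← sdiff_iUnion, iUnion_ball_nat, sdiff_univ, measure_empty] at h
  obtain ⟨k, hk⟩ := (h.eventually_lt_const (pos_iff_ne_zero.mpr hε)).exists
  exact ⟨k, hk⟩

lemma MeasureTheory.measure_diff_eq_of_measure_eq {X : Type*} [MeasurableSpace X] {μ : Measure X}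
    {s t : Set X} (hs : MeasurableSet s) (ht : MeasurableSet t) (h : μ s = μ t) (hfin : μ t ≠ ∞) :
    μ (s \ t) = μ (t \ s) := by
  have h1 := measure_inter_add_sdiff s ht (μ := μ)
  have h2 := measure_inter_add_sdiff t hs (μ := μ)
  rw [inter_comm, h, ← h2] at h1
  exact (ENNReal.add_right_inj ((measure_mono inter_subset_left).trans_lt hfin.lt_top).ne).mp h1

/-- Sets with the same volume, no more fractional perimeter and no more mass away from the origin
than `E`. -/
def Improves (α : ℝ) (E F : Set (EuclideanSpace ℝ (Fin n))) : Prop :=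
  MeasurableSet F ∧ volume F = volume E ∧ fracPerimeter n α F ≤ fracPerimeter n α E ∧
    ∀ r : ℝ, volume (F \ ball 0 r) ≤ volume (E \ ball 0 r)

lemma Improves.polarize {α : ℝ} (hα : 0 ≤ α) {E F : Set (EuclideanSpace ℝ (Fin n))}
    (h : Improves α E F) (p : EuclideanSpace ℝ (Fin n)) : Improves α E (polarize p F) :=
  ⟨measurableSet_polarize p h.1, (volume_polarize p h.1).trans h.2.1,
    (fracPerimeter_polarize_le hα p h.1).trans h.2.2.1, fun r =>
    (le_self_add.trans (volume_polarize_diff_ball_add_le p h.1 r)).trans (h.2.2.2 r)⟩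

lemma iInf_volume_diff_ball_eq_zero {α a : ℝ} (hα : 0 ≤ α) (ha : 0 < a)
    {E : Set (EuclideanSpace ℝ (Fin n))} (hE : MeasurableSet E)
    (hvol : volume E = volume (ball (0 : EuclideanSpace ℝ (Fin n)) a)) :
    ⨅ (F : Set (EuclideanSpace ℝ (Fin n))) (_ : Improves α E F), volume (F \ ball 0 a) = 0 := by
  set I := ⨅ (F : Set (EuclideanSpace ℝ (Fin n))) (_ : Improves α E F), volume (F \ ball 0 a)
    with hI
  have hIle : ∀ F, Improves α E F → I ≤ volume (F \ ball 0 a) := fun F hF => iInf₂_le F hF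
  have hfin : volume E ≠ ∞ := hvol ▸ measure_ball_lt_top.ne
  have hIfin : I ≠ ∞ := ((hIle E ⟨hE, rfl, le_rfl, fun _ => le_rfl⟩).trans_lt
    ((measure_mono sdiff_subset).trans_lt hfin.lt_top)).ne
  by_contra hI0
  have hI2 : I / 2 ≠ 0 := by simpa using hI0
  have half_le : ∀ s t : ℝ≥0∞, I ≤ s + t → t < I / 2 → I / 2 ≤ s := by
    intro s t hst ht
    rw [← ENNReal.sub_half hIfin]
    exact tsub_le_iff_right.mpr (hst.trans (by gcongr))
  obtain ⟨R, hR⟩ := exists_volume_diff_ball_lt hE hfin hI2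
  obtain ⟨η, hη, hηI⟩ := exists_volume_ball_diff_ball_lt n ha hI2
  obtain ⟨K, hK, hKI⟩ := exists_volume_mul_volume_le_of_mirror n (b := a - η) (R := R) hη.1
  have hc : I / 2 * (I / 2) / K ≠ 0 := ENNReal.div_ne_zero.mpr ⟨mul_ne_zero hI2 hI2, hK⟩
  have key : ∀ F, Improves α E F → I + I / 2 * (I / 2) / K ≤ volume (F \ ball 0 a) := by
    intro F hF
    have hFE := hIle F hF
    have hA : I / 2 ≤ volume ((F ∩ ball 0 R) \ ball 0 a) := by
      refine half_le _ _ (hFE.trans (le_trans (measure_mono ?_) (measure_union_le _ _)))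
        ((hF.2.2.2 R).trans_lt hR)
      intro x hx
      by_cases hxR : x ∈ ball 0 R
      · exact Or.inl ⟨⟨hx.1, hxR⟩, hx.2⟩
      · exact Or.inr ⟨hx.1, hxR⟩
    have hC : I / 2 ≤ volume (ball 0 (a - η) \ F) := by
      rw [measure_diff_eq_of_measure_eq hF.1 measurableSet_ball (hF.2.1.trans hvol)
        measure_ball_lt_top.ne] at hFE
      refine half_le _ _ (hFE.trans (le_trans (measure_mono ?_) (measure_union_le _ _))) hηI
      intro x hx
      by_cases hxR : x ∈ ball 0 (a - η)
      · exact Or.inl ⟨hxR, hx.2⟩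
      · exact Or.inr ⟨hx.1, hxR⟩
    have h1 := hKI ((F ∩ ball 0 R) \ ball 0 a) (ball 0 (a - η) \ F)
      ((hF.1.inter measurableSet_ball).diff measurableSet_ball) (measurableSet_ball.diff hF.1)
      sdiff_subset (by rw [sub_add_cancel]; exact sdiff_subset_sdiff_left inter_subset_right)
      (volume (F \ ball 0 a) - I) fun p => by
        refine ENNReal.le_sub_of_add_le_left hIfin
          (le_trans ?_ (volume_polarize_diff_ball_add_le p hF.1 a))
        refine add_le_add (hIle _ (hF.polarize hα p)) (measure_mono (inter_subset_inter ?_ ?_))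
        · exact sdiff_subset_sdiff_left (ball_subset_ball (by linarith [hη.1]))
        · exact preimage_mono (sdiff_subset_sdiff_left inter_subset_left)
    have h2 : I / 2 * (I / 2) / K ≤ volume (F \ ball 0 a) - I :=
      ENNReal.div_le_of_le_mul' ((mul_le_mul' hC hA).trans h1)
    calc _ ≤ I + (volume (F \ ball 0 a) - I) := by gcongr
      _ = _ := add_tsub_cancel_of_le hFE
  exact (ENNReal.lt_add_right hIfin hc).not_ge (le_iInf₂ key)

/-- The fractional perimeter is lower semicontinuous along sequences of sets that converge
almost everywhere. -/
lemma fracPerimeter_le_of_ae_eventually_mem_iff {α : ℝ} {F : ℕ → Set (EuclideanSpace ℝ (Fin n))}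
    {B : Set (EuclideanSpace ℝ (Fin n))} (hF : ∀ k, MeasurableSet (F k)) (hB : MeasurableSet B)
    (h : ∀ᵐ x, ∀ᶠ k in atTop, (x ∈ F k ↔ x ∈ B)) {c : ℝ≥0∞}
    (hc : ∀ k, fracPerimeter n α (F k) ≤ c) : fracPerimeter n α B ≤ c := by
  classical
  have hprod : ∀ G : Set (EuclideanSpace ℝ (Fin n)), MeasurableSet G → fracPerimeter n α G =
      ∫⁻ z : EuclideanSpace ℝ (Fin n) × EuclideanSpace ℝ (Fin n), (if z.1 ∈ G ∧ z.2 ∉ G then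
        ENNReal.ofReal (‖z.1 - z.2‖ ^ (-((n : ℝ) + α))) else 0) ∂(volume.prod volume) := by
    intro G hG
    rw [fracPerimeter_eq_lintegral_lintegral α hG,
      lintegral_prod _ (measurable_perimeter_integrand α hG).aemeasurable]
  have h1 := Measure.quasiMeasurePreserving_fst (μ := volume)
    (ν := (volume : Measure (EuclideanSpace ℝ (Fin n)))).ae h
  have h2 := Measure.quasiMeasurePreserving_snd (ν := volume)
    (μ := (volume : Measure (EuclideanSpace ℝ (Fin n)))).ae h
  rw [hprod B hB]
  calc _ = ∫⁻ z : EuclideanSpace ℝ (Fin n) × EuclideanSpace ℝ (Fin n), liminf (fun k =>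
        if z.1 ∈ F k ∧ z.2 ∉ F k then ENNReal.ofReal (‖z.1 - z.2‖ ^ (-((n : ℝ) + α))) else 0)
        atTop ∂(volume.prod volume) := by
        refine lintegral_congr_ae ?_
        filter_upwards [h1, h2] with z hz1 hz2
        refine (Tendsto.liminf_eq (tendsto_const_nhds.congr' ?_)).symm
        filter_upwards [hz1, hz2] with k hk1 hk2
        simp only [hk1, hk2]
    _ ≤ liminf (fun k => fracPerimeter n α (F k)) atTop := by
        simp only [fun k => hprod (F k) (hF k)]
        exact lintegral_liminf_le fun k => measurable_perimeter_integrand α (hF k)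
    _ ≤ liminf (fun _ => c) atTop := liminf_le_liminf (.of_forall hc)
    _ = c := liminf_const c

/-- The fractional isoperimetric inequality. -/
theorem fracPerimeter_ball_le {α a : ℝ} (hα : 0 ≤ α) (ha : 0 < a)
    {E : Set (EuclideanSpace ℝ (Fin n))} (hE : MeasurableSet E)
    (hvol : volume E = volume (ball (0 : EuclideanSpace ℝ (Fin n)) a)) :
    fracPerimeter n α (ball 0 a) ≤ fracPerimeter n α E := by
  obtain ⟨ε, hε, hsum⟩ := ENNReal.exists_pos_sum_of_countable' one_ne_zero ℕ
  have hex : ∀ k, ∃ F, Improves α E F ∧ volume (F \ ball 0 a) < ε k := by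
    intro k
    have := hε k
    rw [← iInf_volume_diff_ball_eq_zero hα ha hE hvol] at this
    simpa only [iInf_lt_iff, exists_prop] using this
  choose F hF hFε using hex
  have hs1 : ∑' k, volume (F k \ ball 0 a) ≠ ∞ :=
    ((ENNReal.tsum_le_tsum fun k => (hFε k).le).trans_lt (hsum.trans ENNReal.one_lt_top)).ne
  have hs2 : ∑' k, volume (ball 0 a \ F k) ≠ ∞ := by
    simpa only [fun k => measure_diff_eq_of_measure_eq (hF k).1 measurableSet_ball
      ((hF k).2.1.trans hvol) measure_ball_lt_top.ne] using hs1
  refine fracPerimeter_le_of_ae_eventually_mem_iff (fun k => (hF k).1) measurableSet_ball ?_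
    fun k => (hF k).2.2.1
  filter_upwards [ae_eventually_notMem hs1, ae_eventually_notMem hs2] with x h1 h2
  filter_upwards [h1, h2] with k h1 h2
  simp only [Set.mem_sdiff, not_and, not_not] at h1 h2
  exact ⟨h1, h2⟩

end Isoperimetric

section FiniteEnergy

variable {n : ℕ}

lemma integrableOn_Ioi_rpow_mul_min {α : ℝ} (h0 : 0 < α) (h1 : α < 1) :
    IntegrableOn (fun t : ℝ => t ^ (-1 - α) * min 1 t) (Ioi 0) := by
  have hone : ∀ t : ℝ, 0 < t → t ^ (-1 - α) * t = t ^ (-α) := by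
    intro t ht
    nth_rewrite 2 [← Real.rpow_one t]
    rw [← Real.rpow_add ht]
    congr 1
    ring
  rw [← Ioo_union_Ici_eq_Ioi (zero_lt_one' ℝ)]
  refine IntegrableOn.union ?_ ((integrableOn_Ici_iff_integrableOn_Ioi).mpr ?_)
  · refine ((intervalIntegral.integrableOn_Ioo_rpow_iff zero_lt_one).mpr
      (by linarith : -1 < -α)).congr_fun (fun t ht => ?_) measurableSet_Ioo
    simp only [min_eq_right ht.2.le, hone t ht.1]
  · refine (integrableOn_Ioi_rpow_of_lt (by linarith : -1 - α < -1) zero_lt_one).congr_fun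
      (fun t ht => ?_) measurableSet_Ioi
    simp only [min_eq_left (le_of_lt (mem_Ioi.mp ht)), mul_one]

lemma integrable_norm_rpow_mul_min (hn : n ≠ 0) {α : ℝ} (h0 : 0 < α) (h1 : α < 1) :
    Integrable fun z : EuclideanSpace ℝ (Fin n) => ‖z‖ ^ (-((n : ℝ) + α)) * min 1 ‖z‖ := by
  have : NeZero n := ⟨hn⟩
  refine (integrable_fun_norm_addHaar (volume : Measure (EuclideanSpace ℝ (Fin n)))
    (f := fun t => t ^ (-((n : ℝ) + α)) * min 1 t)).mpr ?_
  refine (integrableOn_Ioi_rpow_mul_min h0 h1).congr_fun (fun t ht => ?_) measurableSet_Ioi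
  have ht' : 0 < t := ht
  rw [finrank_euclideanSpace, Fintype.card_fin, smul_eq_mul, ← mul_assoc, ← Real.rpow_natCast,
    ← Real.rpow_add ht', Nat.cast_sub (Nat.one_le_iff_ne_zero.mpr hn)]
  rw [show ((n : ℝ) - (1 : ℕ)) + -((n : ℝ) + α) = -1 - α by push_cast; ring]

lemma fracPerimeter_ball_ne_top (hn : n ≠ 0) {α a : ℝ} (h0 : 0 < α) (h1 : α < 1) (ha : 0 < a) :
    fracPerimeter n α (ball 0 a) ≠ ∞ := by
  classical
  obtain ⟨K, hK, hKv⟩ := exists_volume_ball_diff_ball_le n ha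
  set v := volume (ball (0 : EuclideanSpace ℝ (Fin n)) a)
  have hv : v ≠ ∞ := measure_ball_lt_top.ne
  have hM : max v K ≠ ∞ := by simp [hv, hK]
  have hmeas : Measurable fun w : EuclideanSpace ℝ (Fin n) × EuclideanSpace ℝ (Fin n) =>
      if w.1 ∈ ball (0 : EuclideanSpace ℝ (Fin n)) a ∧ w.1 + w.2 ∉ ball 0 a then
        ENNReal.ofReal (‖w.1 - (w.1 + w.2)‖ ^ (-((n : ℝ) + α))) else 0 :=
    (measurable_perimeter_integrand α measurableSet_ball).comp
      (measurable_fst.prodMk (measurable_fst.add measurable_snd))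
  have hvol : ∀ z : EuclideanSpace ℝ (Fin n),
      volume (ball (0 : EuclideanSpace ℝ (Fin n)) a \ ball 0 (a - ‖z‖)) ≤
        max v K * ENNReal.ofReal (min 1 ‖z‖) := by
    intro z
    rcases le_total 1 ‖z‖ with hz | hz
    · rw [min_eq_left hz, ENNReal.ofReal_one, mul_one]
      exact (measure_mono sdiff_subset).trans (le_max_left _ _)
    · rw [min_eq_right hz]
      exact (hKv _ (norm_nonneg z)).trans (mul_le_mul_left (le_max_right _ _) _)
  have hle : fracPerimeter n α (ball 0 a) ≤ max v K *
      ∫⁻ z : EuclideanSpace ℝ (Fin n),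
        ENNReal.ofReal (‖z‖ ^ (-((n : ℝ) + α)) * min 1 ‖z‖) := by
    calc fracPerimeter n α (ball 0 a) = ∫⁻ x : EuclideanSpace ℝ (Fin n),
          ∫⁻ z : EuclideanSpace ℝ (Fin n), if x ∈ ball 0 a ∧ x + z ∉ ball 0 a then
            ENNReal.ofReal (‖x - (x + z)‖ ^ (-((n : ℝ) + α))) else 0 := by
          rw [fracPerimeter_eq_lintegral_lintegral α measurableSet_ball]
          congr 1 with x
          exact (lintegral_add_left_eq_self (fun y => if x ∈ ball 0 a ∧ y ∉ ball 0 a then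
            ENNReal.ofReal (‖x - y‖ ^ (-((n : ℝ) + α))) else 0) x).symm
      _ = ∫⁻ z : EuclideanSpace ℝ (Fin n),
          ∫⁻ x : EuclideanSpace ℝ (Fin n), if x ∈ ball 0 a ∧ x + z ∉ ball 0 a then
            ENNReal.ofReal (‖x - (x + z)‖ ^ (-((n : ℝ) + α))) else 0 :=
          lintegral_lintegral_swap hmeas.aemeasurable
      _ ≤ ∫⁻ z : EuclideanSpace ℝ (Fin n), ∫⁻ x : EuclideanSpace ℝ (Fin n),
          (ball 0 a \ ball 0 (a - ‖z‖)).indicator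
            (fun _ => ENNReal.ofReal (‖z‖ ^ (-((n : ℝ) + α)))) x := by
          gcongr with z x
          split_ifs with hx
          · rw [sub_add_cancel_left, norm_neg, indicator_of_mem]
            refine ⟨hx.1, fun hxz => hx.2 ?_⟩
            rw [mem_ball_zero_iff] at hxz ⊢
            linarith [norm_add_le x z]
          · exact zero_le
      _ ≤ ∫⁻ z : EuclideanSpace ℝ (Fin n), max v K *
          ENNReal.ofReal (‖z‖ ^ (-((n : ℝ) + α)) * min 1 ‖z‖) := by
          gcongr with z
          rw [lintegral_indicator_const (measurableSet_ball.diff measurableSet_ball),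
            ENNReal.ofReal_mul (by positivity), mul_left_comm]
          gcongr
          exact hvol z
      _ = _ := lintegral_const_mul' _ _ hM
  exact (hle.trans_lt (ENNReal.mul_lt_top hM.lt_top
    (integrable_norm_rpow_mul_min hn h0 h1).lintegral_lt_top)).ne

end FiniteEnergy

/-- A quantitative bathtub principle: among the sets of given measure, `B` minimizes the integral
of `g` if `g` is at most `c₂` on `B` and at least `c₂` outside. -/
lemma MeasureTheory.setLIntegral_add_mul_measure_diff_le {X : Type*} [MeasurableSpace X]
    {μ : Measure X} {g : X → ℝ≥0∞} {A B E : Set X} (hA : MeasurableSet A) (hB : MeasurableSet B)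
    (hE : MeasurableSet E) (hAB : A ⊆ B) {c₁ c₂ : ℝ≥0∞} (hc : c₁ ≤ c₂) (hgA : ∀ x ∈ A, g x ≤ c₁)
    (hgB : ∀ x ∈ B, g x ≤ c₂) (hgBc : ∀ x ∉ B, c₂ ≤ g x) (hEB : μ E = μ B) (hfin : μ B ≠ ∞) :
    ∫⁻ x in B, g x ∂μ + (c₂ - c₁) * μ (A \ E) ≤ ∫⁻ x in E, g x ∂μ := by
  have hle : ∀ {s : Set X} {c : ℝ≥0∞}, MeasurableSet s → (∀ x ∈ s, g x ≤ c) →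
      ∫⁻ x in s, g x ∂μ ≤ c * μ s := fun hs h => by
    rw [← setLIntegral_const]
    exact setLIntegral_mono' hs h
  have hBE : B \ E = (A \ E) ∪ ((B \ A) \ E) := by
    ext x
    have := @hAB x
    simp only [Set.mem_sdiff, mem_union]
    tauto
  have hdisj : Disjoint (A \ E) ((B \ A) \ E) :=
    disjoint_left.mpr fun x hx hx' => hx'.1.2 hx.1
  have hm2 : MeasurableSet ((B \ A) \ E) := (hB.diff hA).diff hE
  rw [← lintegral_inter_add_sdiff g B hE, ← lintegral_inter_add_sdiff g E hB, inter_comm E B,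
    add_assoc]
  gcongr
  calc ∫⁻ x in B \ E, g x ∂μ + (c₂ - c₁) * μ (A \ E)
      ≤ (c₁ * μ (A \ E) + c₂ * μ ((B \ A) \ E)) + (c₂ - c₁) * μ (A \ E) := by
        gcongr
        rw [hBE, lintegral_union hm2 hdisj]
        exact add_le_add (hle (hA.diff hE) fun x hx => hgA x hx.1)
          (hle hm2 fun x hx => hgB x hx.1.1)
    _ = c₂ * μ (B \ E) := by
        rw [hBE, measure_union hdisj hm2, add_right_comm, ← add_mul, add_tsub_cancel_of_le hc,
          mul_add]
    _ = ∫⁻ _ in E \ B, c₂ ∂μ := by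
        rw [setLIntegral_const, measure_diff_eq_of_measure_eq hE hB hEB hfin]
    _ ≤ _ := setLIntegral_mono' (hE.diff hB) fun x hx => hgBc x hx.2

/-- If the nonlocal free energies of a sequence of sets of the given volume converge to that
of the centered ball, then the sets converge to the centered ball in measure. -/
theorem stmt_5 (n : ℕ) (hn : 2 ≤ n) (α : ℝ) (hα : α ∈ Set.Ioo (0 : ℝ) 1)
    (h : ℝ → ℝ) (hconv : ConvexOn ℝ (Set.Ici 0) h) (hmono : StrictMonoOn h (Set.Ici 0))
    (h0 : h 0 = 0) (hpos : ∀ t : ℝ, 0 ≤ t → 0 ≤ h t)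
    (m a : ℝ) (hm : 0 < m) (ha : 0 < a)
    (hvol : volume (ball (0 : EuclideanSpace ℝ (Fin n)) a) = ENNReal.ofReal m)
    (E : ℕ → Set (EuclideanSpace ℝ (Fin n))) (hE : ∀ i, MeasurableSet (E i))
    (hEvol : ∀ i, volume (E i) = ENNReal.ofReal m)
    (henergy : Tendsto
      (fun i => freeEnergy n α (fun x => h ‖x‖) (E i)
        - freeEnergy n α (fun x => h ‖x‖) (ball (0 : EuclideanSpace ℝ (Fin n)) a))
      atTop (𝓝 0)) :
    Tendsto (fun i => volume (symmDiff (E i) (ball (0 : EuclideanSpace ℝ (Fin n)) a)))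
      atTop (𝓝 0) := by
  have hBvol : ∀ i, volume (E i) = volume (ball (0 : EuclideanSpace ℝ (Fin n)) a) := fun i =>
    (hEvol i).trans hvol.symm
  have hBfin : volume (ball (0 : EuclideanSpace ℝ (Fin n)) a) ≠ ∞ := measure_ball_lt_top.ne
  have hle : ∀ {s t : ℝ}, 0 ≤ s → s ≤ t → ENNReal.ofReal (h s) ≤ ENNReal.ofReal (h t) :=
    fun hs hst => ENNReal.ofReal_le_ofReal
      (hmono.monotoneOn (mem_Ici.mpr hs) (mem_Ici.mpr (hs.trans hst)) hst)
  have hgB : ∀ x ∈ ball (0 : EuclideanSpace ℝ (Fin n)) a,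
      ENNReal.ofReal (h ‖x‖) ≤ ENNReal.ofReal (h a) := fun x hx =>
    hle (norm_nonneg x) (mem_ball_zero_iff.mp hx).le
  have henergy_fin : freeEnergy n α (fun x => h ‖x‖) (ball 0 a) ≠ ∞ := by
    refine ENNReal.add_ne_top.mpr
      ⟨fracPerimeter_ball_ne_top (by lia) hα.1 hα.2 ha, ne_top_of_le_ne_top ?_
        (setLIntegral_mono' measurableSet_ball hgB)⟩
    rw [setLIntegral_const]
    exact ENNReal.mul_ne_top ENNReal.ofReal_ne_top hBfin
  rw [ENNReal.tendsto_nhds_zero]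
  intro ε hε
  have hε4 : ε / 4 ≠ 0 := by simpa using hε.ne'
  obtain ⟨η, hη, hηε⟩ := exists_volume_ball_diff_ball_lt n ha hε4
  have hηa : 0 ≤ a - η := by linarith [hη.2]
  have hlt : h (a - η) < h a :=
    hmono (mem_Ici.mpr hηa) (mem_Ici.mpr ha.le) (by linarith [hη.1])
  set κ := ENNReal.ofReal (h a) - ENNReal.ofReal (h (a - η)) with hκ
  have hκ0 : κ ≠ 0 := (tsub_pos_of_lt
    ((ENNReal.ofReal_lt_ofReal_iff ((hpos _ hηa).trans_lt hlt)).mpr hlt)).ne'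
  filter_upwards [henergy.eventually_lt_const (pos_iff_ne_zero.mpr (mul_ne_zero hκ0 hε4))]
    with i hi
  have hbath := setLIntegral_add_mul_measure_diff_le (μ := volume)
    (g := fun x : EuclideanSpace ℝ (Fin n) => ENNReal.ofReal (h ‖x‖)) (measurableSet_ball (x := 0)
      (ε := a - η)) (measurableSet_ball (x := 0) (ε := a)) (hE i)
    (ball_subset_ball (by linarith [hη.1])) (hle hηa (by linarith [hη.1]))
    (fun x hx => hle (norm_nonneg x) (mem_ball_zero_iff.mp hx).le) hgB
    (fun x hx => hle ha.le (by simpa using hx)) (hBvol i) hBfin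
  have hdiff : κ * volume (ball 0 (a - η) \ E i) ≤
      freeEnergy n α (fun x => h ‖x‖) (E i) - freeEnergy n α (fun x => h ‖x‖) (ball 0 a) := by
    refine ENNReal.le_sub_of_add_le_left henergy_fin ?_
    rw [freeEnergy, freeEnergy, add_assoc]
    exact add_le_add (fracPerimeter_ball_le hα.1.le ha (hE i) (hBvol i)) hbath
  have hinner : volume (ball 0 (a - η) \ E i) < ε / 4 :=
    lt_of_mul_lt_mul_left' (hdiff.trans_lt hi)
  have hBE : volume (ball 0 a \ E i) ≤ ε / 4 + ε / 4 := by
    refine (measure_mono ?_).trans ((measure_union_le (ball 0 (a - η) \ E i)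
      (ball 0 a \ ball 0 (a - η))).trans (add_le_add hinner.le hηε.le))
    intro x hx
    by_cases hxη : x ∈ ball 0 (a - η)
    · exact Or.inl ⟨hxη, hx.2⟩
    · exact Or.inr ⟨hx.1, hxη⟩
  calc volume (symmDiff (E i) (ball 0 a))
      ≤ volume (E i \ ball 0 a) + volume (ball 0 a \ E i) := measure_union_le _ _
    _ ≤ (ε / 4 + ε / 4) + (ε / 4 + ε / 4) := by
        rw [measure_diff_eq_of_measure_eq (hE i) measurableSet_ball (hBvol i) hBfin]
        exact add_le_add hBE hBE
    _ = 4 * (ε / 4) := by ring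
    _ = ε := ENNReal.mul_div_cancel (by simp) (by simp)
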